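/- arXiv:1907.07021 — 3 statements merged into one kernel-verified Lean document; each statement's English description precedes it below -/
import Mathlib

section
/- (Denjoy–Koksma inequality.) Let F : ℝ → ℝ be a continuous, strictly increasing map with F(x+1) = F(x) + 1 for all x, inducing a homeomorphism T of the circle ℝ/ℤ, and assume the rotation number α of T is irrational with α ∈ (0,1). Let μ be a T-invariant Borel probability measure on ℝ/ℤ. Let φ : ℝ/ℤ → ℝ have bounded variation with total variation Var(φ), and assume ∫ φ dμ = 0. Let q ≥ 1 be a convergent denominator of α, i.e. the denominator q_n of some continued fraction convergent p_n/q_n of α. Then for every x ∈ ℝ/ℤ one has |∑_{i=0}^{q−1} φ(T^i x)| ≤ Var(φ). -/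
open MeasureTheory Set

/-- At every stage of the continued fraction algorithm for an irrational `α`, the current and
previous continuants are integers `p / q` and `r / u` with determinant `±1`, and `α` is
recovered from them by the complete quotient `ξ⁻¹`, where `ξ` is the current fractional part. -/
theorem exists_int_contsAux {α : ℝ} (hα : Irrational α) (n : ℕ) :
    ∃ (ifp : GenContFract.IntFractPair ℝ) (p q r u : ℤ),
      GenContFract.IntFractPair.stream α n = some ifp ∧ Irrational ifp.fr ∧
      0 < ifp.fr ∧ ifp.fr < 1 ∧
      (GenContFract.of α).contsAux n = ⟨r, u⟩ ∧ (GenContFract.of α).contsAux (n + 1) = ⟨p, q⟩ ∧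
      0 ≤ u ∧ 0 < q ∧ (r * q - p * u = 1 ∨ r * q - p * u = -1) ∧
      α * (q + u * ifp.fr) = p + r * ifp.fr := by
  induction n with
  | zero =>
    have hirr : Irrational (Int.fract α) := by
      rw [← Int.self_sub_floor]; exact hα.sub_intCast _
    refine ⟨GenContFract.IntFractPair.of α, ⌊α⌋, 1, 1, 0, rfl, hirr, ?_, Int.fract_lt_one α,
      by simp [GenContFract.contsAux], by simp [GenContFract.contsAux, GenContFract.of_h_eq_floor],
      le_rfl, one_pos, by simp, ?_⟩
    · exact lt_of_le_of_ne (Int.fract_nonneg α) hirr.ne_zero.symm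
    · simp [GenContFract.IntFractPair.of]
  | succ n ih =>
    obtain ⟨ifp, p, q, r, u, hs, hirr, hpos, hlt, hc, hc', hu, hq, hdet, hα'⟩ := ih
    have hinv : Irrational ifp.fr⁻¹ := hirr.inv
    have hirr' : Irrational (Int.fract ifp.fr⁻¹) := by
      rw [← Int.self_sub_floor]; exact hinv.sub_intCast _
    have hb : 1 ≤ ⌊ifp.fr⁻¹⌋ := by
      rw [Int.le_floor]; push_cast; exact (one_lt_inv₀ hpos).2 hlt |>.le
    have hget := GenContFract.get?_of_eq_some_of_get?_intFractPair_stream_fr_ne_zero hs hpos.ne'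
    refine ⟨GenContFract.IntFractPair.of ifp.fr⁻¹, ⌊ifp.fr⁻¹⌋ * p + r, ⌊ifp.fr⁻¹⌋ * q + u, p, q,
      GenContFract.IntFractPair.stream_succ_of_some hs hpos.ne', hirr',
      lt_of_le_of_ne (Int.fract_nonneg _) hirr'.ne_zero.symm, Int.fract_lt_one _, hc', ?_, hq.le,
      by nlinarith, ?_, ?_⟩
    · rw [GenContFract.contsAux_recurrence hget hc hc']
      simp [GenContFract.IntFractPair.of]
    · rcases hdet with h | h
      · right; linarith
      · left; linarith
    · have hfr : (GenContFract.IntFractPair.of ifp.fr⁻¹).fr = ifp.fr⁻¹ - ⌊ifp.fr⁻¹⌋ :=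
        (Int.self_sub_floor _).symm
      rw [hfr]
      have hne := hpos.ne'
      generalize ⌊ifp.fr⁻¹⌋ = b at *
      push_cast
      field_simp
      linear_combination hα'

/-- Every convergent `p / q` of an irrational `α` has a companion fraction `r / u` such that the
two are Farey neighbours enclosing `α`, and `q α - p` is at most `u α - r` in absolute value. -/
theorem exists_farey_neighbor_of_dens {α : ℝ} (hα : Irrational α) {q n : ℕ}
    (hq : (q : ℝ) = (GenContFract.of α).dens n) :
    ∃ p r u ε : ℤ, (ε = 1 ∨ ε = -1) ∧ 0 ≤ u ∧ r * q - p * u = ε ∧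
      0 < ε * (q * α - p) ∧ ε * (q * α - p) ≤ ε * (r - u * α) := by
  obtain ⟨ifp, p, q', r, u, -, -, hpos, hlt, -, hc', hu, hq', hdet, hval⟩ :=
    exists_int_contsAux hα n
  have hqq : (q' : ℤ) = q := by
    rw [GenContFract.den_eq_conts_b, GenContFract.nth_cont_eq_succ_nth_contAux, hc'] at hq
    have hq : (q : ℝ) = q' := hq
    exact_mod_cast hq.symm
  subst hqq
  set ξ := ifp.fr
  have hqR : (0 : ℝ) < q := by exact_mod_cast hq'
  have huR : (0 : ℝ) ≤ u := by exact_mod_cast hu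
  have hD : 0 < (q : ℝ) + u * ξ := by positivity
  have hε : (r * q - p * u) * (r * q - p * u) = (1 : ℝ) := by
    exact_mod_cast (by rcases hdet with h | h <;> rw [h] <;> rfl :
      (r * q - p * u) * (r * q - p * u) = 1)
  push_cast at hval
  have hβ : (q + u * ξ) * (((r * q - p * u : ℤ) : ℝ) * (q * α - p)) = ξ := by
    push_cast
    linear_combination (q * (r * q - p * u) : ℝ) * hval + ξ * hε
  have hη : ξ * (((r * q - p * u : ℤ) : ℝ) * (r - u * α)) =
      ((r * q - p * u : ℤ) : ℝ) * (q * α - p) := by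
    push_cast
    linear_combination (-(r * q - p * u) : ℝ) * hval
  have hβpos : 0 < ((r * q - p * u : ℤ) : ℝ) * (q * α - p) :=
    (mul_pos_iff_of_pos_left hD).1 (by rw [hβ]; exact hpos)
  refine ⟨p, r, u, r * q - p * u, hdet, hu, rfl, hβpos, ?_⟩
  have : 0 < ((r * q - p * u : ℤ) : ℝ) * (r - u * α) :=
    (mul_pos_iff_of_pos_left hpos).1 (by rw [hη]; exact hβpos)
  nlinarith

/-- If `p / q` and `r / u` are Farey neighbours enclosing `τ`, then `n τ + m` does not decrease
when `n p + m q` is kept constant, provided the change of `n` is not too large in the direction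
opposite to the sign of `q τ - p`. -/
theorem linear_form_le_of_eq {τ : ℝ} {p r u ε n m n' m' : ℤ} {q : ℕ} (hq : 0 < q)
    (hε : ε = 1 ∨ ε = -1) (hdet : r * q - p * u = ε) (hβ : 0 < ε * (q * τ - p))
    (h : n' * p + m' * q = n * p + m * q) (hn : -(q : ℤ) < ε * (n' - n)) :
    n * τ + m ≤ n' * τ + m' := by
  have hε2 : ε * ε = 1 := by rcases hε with rfl | rfl <;> rfl
  obtain ⟨K, hK⟩ : ∃ K, K = (n' - n) * r + (m' - m) * u := ⟨_, rfl⟩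
  have hn' : ε * (n' - n) = K * q := by
    rw [hK, ← hdet]; linear_combination -u * h
  have hm' : ε * (m' - m) = -K * p := by
    rw [hK, ← hdet]; linear_combination r * h
  have hK0 : 0 ≤ K := by
    have : (-1 : ℤ) * q < K * q := by linarith
    have := lt_of_mul_lt_mul_right this (by positivity)
    omega
  have key : (n' * τ + m') - (n * τ + m) = K * (ε * (q * τ - p)) := by
    have e1 : (ε * (n' - n) : ℝ) = K * q := by exact_mod_cast hn'
    have e2 : (ε * (m' - m) : ℝ) = -K * p := by exact_mod_cast hm'
    have e3 : (ε * ε : ℝ) = 1 := by exact_mod_cast hε2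
    linear_combination (ε * τ) * e1 + ε * e2 - ((n' - n) * τ + (m' - m)) * e3
  have : (0 : ℝ) ≤ K * (ε * (q * τ - p)) := by
    have : (0 : ℝ) ≤ K := by exact_mod_cast hK0
    positivity
  linarith

/-- If `p / q` and `r / u` are Farey neighbours enclosing `τ`, then `n τ + m` does not decrease
when `n p + m q` increases by one, provided the change of `n` is not too large in the direction
opposite to the sign of `q τ - p`. -/
theorem linear_form_le_of_eq_add_one {τ : ℝ} {p r u ε n m n' m' : ℤ} {q : ℕ} (hq : 0 < q)
    (hε : ε = 1 ∨ ε = -1) (hu : 0 ≤ u) (hdet : r * q - p * u = ε)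
    (hβ : 0 < ε * (q * τ - p)) (hη : ε * (q * τ - p) ≤ ε * (r - u * τ))
    (h : n' * p + m' * q = n * p + m * q + 1) (hn : -(2 * q : ℤ) < ε * (n' - n)) :
    n * τ + m ≤ n' * τ + m' := by
  have hε2 : ε * ε = 1 := by rcases hε with rfl | rfl <;> rfl
  obtain ⟨K, hK⟩ : ∃ K, K = (n' - n) * r + (m' - m) * u := ⟨_, rfl⟩
  have hn' : ε * (n' - n) = K * q - u := by
    rw [hK, ← hdet]; linear_combination -u * h
  have hm' : ε * (m' - m) = -K * p + r := by
    rw [hK, ← hdet]; linear_combination r * h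
  have hK0 : -1 ≤ K := by
    have : (-2 : ℤ) * q < K * q := by linarith
    have := lt_of_mul_lt_mul_right this (by positivity)
    omega
  have key : (n' * τ + m') - (n * τ + m) = K * (ε * (q * τ - p)) + ε * (r - u * τ) := by
    have e1 : (ε * (n' - n) : ℝ) = K * q - u := by exact_mod_cast hn'
    have e2 : (ε * (m' - m) : ℝ) = -K * p + r := by exact_mod_cast hm'
    have e3 : (ε * ε : ℝ) = 1 := by exact_mod_cast hε2
    linear_combination (ε * τ) * e1 + ε * e2 - ((n' - n) * τ + (m' - m)) * e3
  have : (0 : ℝ) ≤ (K + 1) * (ε * (q * τ - p)) := by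
    have : (-1 : ℝ) ≤ K := by exact_mod_cast hK0
    exact mul_nonneg (by linarith) hβ.le
  linarith

namespace CircleDeg1Lift

/-- The lifted orbit of a circle map with irrational rotation number is ordered like that of the
rotation. -/
theorem iterate_add_le_iterate_add (F : CircleDeg1Lift)
    (hF : Irrational F.translationNumber) (x : ℝ) {n n' : ℕ} {m m' : ℤ}
    (h : n * F.translationNumber + m ≤ n' * F.translationNumber + m') :
    F^[n] x + m ≤ F^[n'] x + m' := by
  rcases le_total n n' with hn | hn
  · obtain ⟨d, rfl⟩ := Nat.exists_eq_add_of_le hn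
    have hd : ((m - m' : ℤ) : ℝ) ≤ (F ^ d).translationNumber := by
      rw [translationNumber_pow]; push_cast at h ⊢; linarith
    rw [Nat.add_comm, Function.iterate_add_apply, ← coe_pow F d]
    rcases hd.lt_or_eq with hd | hd
    · have := lt_map_of_int_lt_translationNumber _ hd (F^[n] x)
      push_cast at this; linarith
    · rcases Nat.eq_zero_or_pos d with rfl | hd0
      · simp only [pow_zero, translationNumber_one] at hd
        push_cast at hd
        simp only [pow_zero, coe_one, id]
        linarith
      · rw [translationNumber_pow] at hd
        exact absurd hd.symm ((hF.natCast_mul hd0.ne').ne_int _)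
  · obtain ⟨d, rfl⟩ := Nat.exists_eq_add_of_le hn
    have hd : (F ^ d).translationNumber ≤ ((m' - m : ℤ) : ℝ) := by
      rw [translationNumber_pow]; push_cast at h ⊢; linarith
    rw [Nat.add_comm n' d, Function.iterate_add_apply, ← coe_pow F d]
    rcases hd.lt_or_eq with hd | hd
    · have := map_lt_of_translationNumber_lt_int _ hd (F^[n'] x)
      push_cast at this; linarith
    · rcases Nat.eq_zero_or_pos d with rfl | hd0
      · simp only [pow_zero, translationNumber_one] at hd
        push_cast at hd
        simp only [pow_zero, coe_one, id]
        linarith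
      · rw [translationNumber_pow] at hd
        exact absurd hd ((hF.natCast_mul hd0.ne').ne_int _)

/-- If `p / q` and `r / u` are Farey neighbours enclosing the rotation number, the first `q` points
of a lifted orbit and their integer translates can be enumerated in increasing order so that
`F^[i]` shifts the enumeration by `i * p` up to an error of at most one place, always on the same
side. -/
theorem exists_monotone_enumeration (F : CircleDeg1Lift)
    (hF : Irrational F.translationNumber) {p r u ε : ℤ} {q : ℕ} (hq : 0 < q)
    (hε : ε = 1 ∨ ε = -1) (hu : 0 ≤ u) (hdet : r * q - p * u = ε)
    (hβ : 0 < ε * (q * F.translationNumber - p))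
    (hη : ε * (q * F.translationNumber - p) ≤ ε * (r - u * F.translationNumber)) (x : ℝ) :
    ∃ (a : ℤ → ℝ) (e : ℤ), Monotone a ∧ (∀ k, a (k + q) = a k + 1) ∧
      (∀ i < q, a (i * p) = F^[i] x) ∧
      ∀ k, ∀ i < q, a (k + i * p + e) ≤ F^[i] (a k) ∧ F^[i] (a k) ≤ a (k + i * p + e + 1) := by
  set τ := F.translationNumber
  have hqZ : (0 : ℤ) < q := by exact_mod_cast hq
  have hε2 : ε * ε = 1 := by rcases hε with rfl | rfl <;> rfl
  have hex : ∀ k : ℤ, ∃ (j : ℕ) (m : ℤ), j < q ∧ j * p + m * q = k := by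
    intro k
    have h0 := Int.emod_nonneg (-(k * ε * u)) hqZ.ne'
    have h1 := Int.emod_lt_of_pos (-(k * ε * u)) hqZ
    have h2 := Int.emod_add_mul_ediv (-(k * ε * u)) q
    refine ⟨(-(k * ε * u) % q).toNat, k * ε * r + p * (-(k * ε * u) / q), by omega, ?_⟩
    rw [Int.toNat_of_nonneg h0]
    linear_combination p * h2 + k * ε * hdet + k * hε2
  choose j m hj hjm using hex
  have uniq : ∀ (n : ℕ) (l k : ℤ), n < q → n * p + l * q = k → j k = n ∧ m k = l := by
    intro n l k hn h
    have e := (hjm k).trans h.symm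
    have e1 : ((j k : ℤ) - n) * ε = q * ((j k - n) * r + (m k - l) * u) := by
      rw [← hdet]; linear_combination -u * e
    have hdvd : (q : ℤ) ∣ (j k : ℤ) - n := by
      have : ((j k : ℤ) - n) = q * (((j k - n) * r + (m k - l) * u) * ε) := by
        linear_combination ε * e1 - ((j k : ℤ) - n) * hε2
      exact ⟨_, this⟩
    have hjk := hj k
    have h0 : (j k : ℤ) - n = 0 :=
      Int.eq_zero_of_abs_lt_dvd hdvd (by rw [abs_lt]; constructor <;> omega)
    have hjn : j k = n := by omega
    refine ⟨hjn, ?_⟩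
    rw [hjn] at e
    exact mul_right_cancel₀ hqZ.ne' (by linarith)
  have hadd : ∀ (n i : ℕ) (l : ℤ), F^[i] (F^[n] x + l) = F^[i + n] x + l := by
    intro n i l
    rw [← coe_pow, map_add_int, coe_pow, Function.iterate_add_apply]
  have hle : ∀ {n n' : ℕ} {l l' : ℤ}, ((n : ℤ) : ℝ) * τ + l ≤ ((n' : ℤ) : ℝ) * τ + l' →
      F^[n] x + l ≤ F^[n'] x + l' := fun h => F.iterate_add_le_iterate_add hF x (by exact_mod_cast h)
  refine ⟨fun k => F^[j k] x + m k, if ε = 1 then 0 else -1, ?_, ?_, ?_, ?_⟩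
  · refine monotone_int_of_le_succ fun k => hle ?_
    have h1 := hj k
    have h2 := hj (k + 1)
    refine linear_form_le_of_eq_add_one hq hε hu hdet hβ hη ?_ ?_
    · rw [hjm, hjm]
    · rcases hε with rfl | rfl <;> omega
  · intro k
    obtain ⟨h1, h2⟩ := uniq (j k) (m k + 1) (k + q) (hj k) (by linear_combination hjm k)
    simp only [h1, h2]; push_cast; ring
  · intro i hi
    obtain ⟨h1, h2⟩ := uniq i 0 (i * p) hi (by ring)
    simp [h1, h2]
  · intro k i hi
    have hk := hj k
    have hjmk := hjm k
    simp only [hadd]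
    rcases hε with rfl | rfl
    · simp only [if_true, add_zero]
      have h1 := hj (k + i * p)
      have h2 := hj (k + i * p + 1)
      have h3 := hjm (k + i * p)
      have h4 := hjm (k + i * p + 1)
      have hjle : j (k + i * p) ≤ i + j k := by
        rcases lt_or_ge (i + j k) q with h | h
        · exact (uniq (i + j k) (m k) _ h (by push_cast; linear_combination hjmk)).1.le
        · omega
      constructor
      · apply hle
        refine linear_form_le_of_eq hq (Or.inl rfl) hdet hβ ?_ ?_
        · rw [h3]; push_cast; linear_combination hjmk
        · push_cast; omega
      · apply hle
        refine linear_form_le_of_eq_add_one hq (Or.inl rfl) hu hdet hβ hη ?_ ?_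
        · rw [h4]; push_cast; linear_combination -hjmk
        · push_cast; omega
    · simp only [show ¬ (-1 : ℤ) = 1 by decide, if_false, neg_add_cancel_right]
      have h1 := hj (k + i * p)
      have h2 := hj (k + i * p + -1)
      have h3 := hjm (k + i * p)
      have h4 := hjm (k + i * p + -1)
      have hjle : j (k + i * p) ≤ i + j k := by
        rcases lt_or_ge (i + j k) q with h | h
        · exact (uniq (i + j k) (m k) _ h (by push_cast; linear_combination hjmk)).1.le
        · omega
      constructor
      · apply hle
        refine linear_form_le_of_eq_add_one hq (Or.inr rfl) hu hdet hβ hη ?_ ?_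
        · rw [h4]; push_cast; linear_combination hjmk
        · push_cast; omega
      · apply hle
        refine linear_form_le_of_eq hq (Or.inr rfl) hdet hβ ?_ ?_
        · rw [h3]; push_cast; linear_combination -hjmk
        · push_cast; omega

end CircleDeg1Lift

/-- A `q`-periodic function has the same sum along any arithmetic progression of length `q` whose
step is coprime to `q`. -/
theorem sum_range_arithmetic_progression {G : ℤ → ℝ} {q : ℕ} (hG : Function.Periodic G q)
    {p : ℤ} (hp : IsCoprime p q) (c : ℤ) :
    ∑ i ∈ Finset.range q, G (c + i * p) = ∑ i ∈ Finset.range q, G i := by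
  rcases Nat.eq_zero_or_pos q with rfl | hq
  · simp
  have hqZ : (0 : ℤ) < q := by exact_mod_cast hq
  have hmod : ∀ k : ℤ, G k = G ((k % q).toNat : ℕ) := by
    intro k
    rw [Int.toNat_of_nonneg (Int.emod_nonneg k hqZ.ne')]
    conv_lhs => rw [← Int.emod_add_mul_ediv k q, mul_comm]
    exact (hG.int_mul (k / q)) _
  have hmaps : ∀ i ∈ Finset.range q, ((c + i * p) % q).toNat ∈ Finset.range q := by
    intro i _
    have := Int.emod_lt_of_pos (c + i * p) hqZ
    rw [Finset.mem_range]; omega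
  have hinj : Set.InjOn (fun i : ℕ => ((c + i * p) % q).toNat) (Finset.range q) := by
    intro i hi i' hi' h
    have h1 := Int.emod_nonneg (c + i * p) hqZ.ne'
    have h2 := Int.emod_nonneg (c + i' * p) hqZ.ne'
    have h3 : (c + i * p) % q = (c + i' * p) % q := by
      simp only at h; omega
    have h4 : (q : ℤ) ∣ (i' - i) * p := by
      have := Int.ModEq.dvd h3
      rwa [show c + i' * p - (c + i * p) = (i' - i) * p by ring] at this
    have h5 := hp.symm.dvd_of_dvd_mul_right h4
    simp only [Finset.coe_range, Set.mem_Iio] at hi hi'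
    have := Int.eq_zero_of_abs_lt_dvd h5 (by rw [abs_lt]; constructor <;> omega)
    omega
  refine Finset.sum_nbij (fun i : ℕ => ((c + i * p) % q).toNat) hmaps hinj ?_ fun i _ => hmod _
  exact Finset.surjOn_of_injOn_of_card_le _ hmaps hinj le_rfl

/-- A `1`-periodic function of bounded variation on `[0,1]` admits a function, increasing by the
total variation over each period, whose increments dominate its own. -/
theorem exists_variation_majorant {f : ℝ → ℝ} (hf : Function.Periodic f 1) {V : ℝ} (hV : 0 ≤ V)
    (hBV : eVariationOn f (Icc 0 1) = ENNReal.ofReal V) :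
    ∃ v : ℝ → ℝ, (∀ t, v (t + 1) = v t + V) ∧ ∀ a b, a ≤ b → |f b - f a| ≤ v b - v a := by
  set w : ℝ → ℝ := fun s => (eVariationOn f (Icc 0 s)).toReal
  have hw1 : w 1 = V := by simp only [w, hBV, ENNReal.toReal_ofReal hV]
  have hw0 : w 0 = 0 := by simp [w]
  have hfin : ∀ s ≤ 1, eVariationOn f (Icc 0 s) ≠ ⊤ := fun s hs =>
    ne_top_of_le_ne_top (hBV ▸ ENNReal.ofReal_ne_top) (eVariationOn.mono f (Icc_subset_Icc_right hs))
  have hw : ∀ s s', 0 ≤ s → s ≤ s' → s' ≤ 1 → |f s' - f s| ≤ w s' - w s := by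
    intro s s' h0 hs h1
    have hadd := eVariationOn.Icc_add_Icc f (s := univ) h0 hs (mem_univ s)
    simp only [univ_inter] at hadd
    have hfin' : eVariationOn f (Icc s s') ≠ ⊤ :=
      ne_top_of_le_ne_top (hfin s' h1) (hadd ▸ le_add_self)
    have hw' : w s' - w s = (eVariationOn f (Icc s s')).toReal := by
      simp only [w, ← hadd, ENNReal.toReal_add (hfin s (hs.trans h1)) hfin']; ring
    rw [hw', ← Real.dist_eq, dist_edist]
    exact ENNReal.toReal_mono hfin' (eVariationOn.edist_le f ⟨hs, le_rfl⟩ ⟨le_rfl, hs⟩)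
  have hfract : ∀ t, f t = f (Int.fract t) := fun t => by
    rw [← Int.self_sub_floor, ← mul_one (⌊t⌋ : ℝ)]
    exact (hf.sub_int_mul_eq ⌊t⌋).symm
  refine ⟨fun t => ⌊t⌋ * V + w (Int.fract t), fun t => ?_, fun a b hab => ?_⟩
  · simp only [Int.floor_add_one, Int.fract_add_one]; push_cast; ring
  · have ha := Int.fract_nonneg a
    have ha' := (Int.fract_lt_one a).le
    have hb := Int.fract_nonneg b
    have hb' := (Int.fract_lt_one b).le
    simp only
    rw [hfract a, hfract b]
    rcases (Int.floor_mono hab).eq_or_lt with h | h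
    · have : Int.fract a ≤ Int.fract b := by
        rw [← Int.self_sub_floor, ← Int.self_sub_floor, h]; linarith
      rw [h]; linarith [hw _ _ ha this hb']
    · have h1 := hw _ _ ha ha' le_rfl
      have h2 := hw _ _ le_rfl hb hb'
      rw [hw1] at h1
      rw [hw0] at h2
      have h3 : f 1 = f 0 := by simpa using hf 0
      have h4 : ((⌊a⌋ : ℝ) + 1) * V ≤ ⌊b⌋ * V :=
        mul_le_mul_of_nonneg_right (by exact_mod_cast h) hV
      have := abs_sub_le (f (Int.fract b)) (f 0) (f (Int.fract a))
      rw [h3] at h1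
      linarith

/-- Along two orbits of a circle map, the sums of a function of bounded variation up to a time `q`
differ by at most the variation, if the rotation number lies between a fraction `p / q` and a
Farey neighbour. -/
theorem abs_sum_sub_sum_le_variation (F : CircleDeg1Lift)
    (hF : Irrational F.translationNumber) {p r u ε : ℤ} {q : ℕ} (hq : 0 < q)
    (hε : ε = 1 ∨ ε = -1) (hu : 0 ≤ u) (hdet : r * q - p * u = ε)
    (hβ : 0 < ε * (q * F.translationNumber - p))
    (hη : ε * (q * F.translationNumber - p) ≤ ε * (r - u * F.translationNumber))
    {f v : ℝ → ℝ} {V : ℝ} (hf : Function.Periodic f 1) (hv1 : ∀ t, v (t + 1) = v t + V)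
    (hv : ∀ a b, a ≤ b → |f b - f a| ≤ v b - v a) (x y : ℝ) :
    |∑ i ∈ Finset.range q, f (F^[i] x) - ∑ i ∈ Finset.range q, f (F^[i] y)| ≤ V := by
  obtain ⟨a, e, hmono, hper, horb, hshift⟩ :=
    F.exists_monotone_enumeration hF hq hε hu hdet hβ hη x
  have hcop : IsCoprime p q := by
    refine ⟨-u * ε, r * ε, ?_⟩
    have hε2 : ε * ε = 1 := by rcases hε with rfl | rfl <;> rfl
    linear_combination ε * hdet + hε2
  have hperm : ∀ l k : ℤ, a (k + l * q) = a k + l := by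
    intro l
    induction l with
    | zero => simp
    | succ l ih =>
      intro k
      rw [show k + ((l : ℤ) + 1) * q = k + l * q + q by ring, hper, ih]; push_cast; ring
    | pred l ih =>
      intro k
      have := hper (k + (-(l : ℤ) - 1) * q)
      rw [show k + (-(l : ℤ) - 1) * q + q = k + (-(l : ℤ)) * q by ring, ih] at this
      push_cast at this ⊢; linarith
  obtain ⟨s, hs, hs'⟩ : ∃ s, a s ≤ y ∧ y < a (s + 1) := by
    have hbdd : ∃ b : ℤ, ∀ k, a k ≤ y → k ≤ b := by
      refine ⟨0 + (⌊y - a 0⌋ + 1) * q, fun k hk => ?_⟩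
      by_contra! hlt
      have h1 := hmono hlt.le
      rw [hperm] at h1
      have h2 := Int.lt_floor_add_one (y - a 0)
      push_cast at h1; linarith
    obtain ⟨s, hs, hmax⟩ := Int.exists_greatest_of_bdd hbdd ⟨0 + ⌊y - a 0⌋ * q, by
      rw [hperm]; linarith [Int.floor_le (y - a 0)]⟩
    refine ⟨s, hs, ?_⟩
    by_contra! h
    have := hmax _ h
    omega
  have hG : Function.Periodic (fun k => f (a k)) (q : ℤ) := fun k => by
    simp only [hper, hf (a k)]
  have hsum : ∀ c, ∑ i ∈ Finset.range q, f (a (c + i * p)) = ∑ i ∈ Finset.range q, f (F^[i] x) := by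
    intro c
    rw [sum_range_arithmetic_progression hG hcop, ← sum_range_arithmetic_progression hG hcop 0]
    refine Finset.sum_congr rfl fun i hi => ?_
    rw [zero_add, horb i (Finset.mem_range.1 hi)]
  have hW : Function.Periodic (fun k : ℤ => v (a (k + 2)) - v (a k)) (q : ℤ) := fun k => by
    simp only [show k + (q : ℤ) + 2 = k + 2 + q by ring, hper, hv1]; ring
  have hWsum : ∑ i ∈ Finset.range q, (v (a (s + e + i * p + 2)) - v (a (s + e + i * p))) = 2 * V := by
    rw [sum_range_arithmetic_progression hW hcop]
    have h1 := Finset.sum_range_sub (fun i : ℕ => v (a i)) q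
    have h2 := Finset.sum_range_sub (fun i : ℕ => v (a (i + 1))) q
    have e0 := hper 0
    have e1 := hper 1
    simp only [zero_add] at e0
    rw [add_comm] at e1
    push_cast at h1 h2
    simp only [e0, e1, hv1, add_sub_cancel_left] at h1 h2
    rw [two_mul]
    nth_rewrite 1 [← h1]
    rw [← h2, ← Finset.sum_add_distrib]
    refine Finset.sum_congr rfl fun i _ => ?_
    rw [show (i : ℤ) + 2 = i + 1 + 1 by ring]; ring
  have hbound : ∀ i ∈ Finset.range q,
      |(f (F^[i] y) - f (a (s + e + i * p))) + (f (F^[i] y) - f (a (s + e + 2 + i * p)))| ≤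
        v (a (s + e + i * p + 2)) - v (a (s + e + i * p)) := by
    intro i hi
    have hi := Finset.mem_range.1 hi
    have hm : Monotone F^[i] := F.monotone.iterate i
    have h1 := (hshift s i hi).1.trans (hm hs)
    have h2 := (hm hs'.le).trans (hshift (s + 1) i hi).2
    rw [show s + i * p + e = s + e + i * p by ring] at h1
    rw [show s + 1 + i * p + e + 1 = s + e + i * p + 2 by ring] at h2
    rw [show s + e + 2 + i * p = s + e + i * p + 2 by ring]
    have h3 := hv _ _ h1
    have h4 := hv _ _ h2
    rw [abs_sub_comm] at h4
    linarith [abs_add_le (f (F^[i] y) - f (a (s + e + i * p)))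
      (f (F^[i] y) - f (a (s + e + i * p + 2)))]
  have htotal := (Finset.abs_sum_le_sum_abs _ _).trans (Finset.sum_le_sum hbound)
  rw [hWsum, Finset.sum_add_distrib, Finset.sum_sub_distrib, Finset.sum_sub_distrib,
    hsum, hsum, ← two_mul, abs_mul, abs_two, abs_sub_comm] at htotal
  linarith

/-- A function on `ℝ / ℤ` is measurable if its lift to `ℝ` is. -/
theorem AddCircle.measurable_of_measurable_comp_coe {φ : AddCircle (1 : ℝ) → ℝ}
    (h : Measurable fun t : ℝ => φ t) : Measurable φ := by
  have h' : Measurable fun z => φ ((AddCircle.measurableEquivIoc 1 0 z : ℝ) : AddCircle (1 : ℝ)) :=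
    h.comp (measurable_subtype_coe.comp (AddCircle.measurableEquivIoc 1 0).measurable)
  convert h' using 2 with z
  exact congrArg φ AddCircle.coe_equivIoc.symm

/-- **Denjoy–Koksma inequality.**  Let `F` be a continuous strictly increasing lift of a
circle homeomorphism `T` of `ℝ/ℤ` (i.e. `F (x+1) = F x + 1`), whose rotation number is an
irrational `α ∈ (0,1)`.  Let `μ` be a `T`-invariant Borel probability measure, let
`φ : ℝ/ℤ → ℝ` have bounded variation `V` (as a function on `[0,1]`) and zero mean with
respect to `μ`.  If `q ≥ 1` is a denominator of a continued-fraction convergent of `α`,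
then the Birkhoff sums of length `q` of `φ` are bounded by `V` at every point. -/
theorem denjoy_koksma
    (F : CircleDeg1Lift) (hFc : Continuous F) (hFs : StrictMono F)
    (T : AddCircle (1 : ℝ) → AddCircle (1 : ℝ))
    (hT : ∀ x : ℝ, T (x : AddCircle (1 : ℝ)) = ((F x : ℝ) : AddCircle (1 : ℝ)))
    (α : ℝ) (hα_irr : Irrational α) (hα_mem : α ∈ Set.Ioo (0 : ℝ) 1)
    (hρ : ∃ k : ℤ, F.translationNumber = α + k)
    (μ : Measure (AddCircle (1 : ℝ))) [IsProbabilityMeasure μ]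
    (hμ : MeasurePreserving T μ μ)
    (φ : AddCircle (1 : ℝ) → ℝ) (V : ℝ)
    (hBV : eVariationOn (fun t : ℝ => φ (t : AddCircle (1 : ℝ))) (Set.Icc 0 1)
      = ENNReal.ofReal V)
    (hV : 0 ≤ V)
    (hint : ∫ z, φ z ∂μ = 0)
    (q : ℕ) (hq1 : 1 ≤ q)
    (hq : ∃ n : ℕ, (q : ℝ) = (GenContFract.of α).dens n)
    (x : AddCircle (1 : ℝ)) :
    |∑ i ∈ Finset.range q, φ (T^[i] x)| ≤ V := by
  obtain ⟨n, hn⟩ := hq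
  obtain ⟨k, hk⟩ := hρ
  obtain ⟨p, r, u, ε, hε, hu, hdet, hβ, hη⟩ := exists_farey_neighbor_of_dens hα_irr hn
  have hF : Irrational F.translationNumber := hk ▸ hα_irr.add_intCast k
  set f : ℝ → ℝ := fun t => φ t
  have hf : Function.Periodic f 1 := fun t => by simp [f]
  obtain ⟨v, hv1, hv⟩ := exists_variation_majorant hf hV hBV
  have hiter : ∀ (i : ℕ) (t : ℝ), T^[i] t = (F^[i] t : ℝ) := fun i t => by
    induction i with
    | zero => rfl
    | succ i ih => rw [Function.iterate_succ_apply', Function.iterate_succ_apply', ih, hT]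
  have hdiff : ∀ y, |∑ i ∈ Finset.range q, φ (T^[i] x) - ∑ i ∈ Finset.range q, φ (T^[i] y)| ≤ V := by
    intro y
    induction x using QuotientAddGroup.induction_on with | H x
    induction y using QuotientAddGroup.induction_on with | H y
    simp only [hiter]
    refine abs_sum_sub_sum_le_variation F hF (p := p + k * q) (r := r + k * u) hq1 hε hu
      (by rw [← hdet]; ring) ?_ ?_ hf hv1 hv x y
    · rw [hk]; push_cast; convert hβ using 2; ring
    · rw [hk]; push_cast; convert hη using 2 <;> ring
  have hfm : Measurable f := by
    have hmv : Monotone v := fun a b h => sub_nonneg.1 ((abs_nonneg _).trans (hv a b h))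
    have hmf : Monotone fun t => v t - f t := fun a b h => by
      have := (le_abs_self _).trans (hv a b h)
      simp only; linarith
    convert hmv.measurable.sub hmf.measurable using 1
    ext t; simp
  have hφm : Measurable φ := AddCircle.measurable_of_measurable_comp_coe hfm
  have hφi : Integrable φ μ := by
    refine Integrable.of_bound hφm.aestronglyMeasurable (|f 0| + V) (ae_of_all _ fun z => ?_)
    obtain ⟨t, ht, rfl⟩ : ∃ t ∈ Ico (0 : ℝ) (0 + 1), (t : AddCircle (1 : ℝ)) = z :=
      ⟨_, (AddCircle.equivIco 1 0 z).2, AddCircle.coe_equivIco⟩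
    have h1 := hv 0 t ht.1
    have h2 := (abs_nonneg _).trans (hv t (0 + 1) ht.2.le)
    have h3 := hv1 0
    have h4 : |f t| ≤ |f 0| + |f t - f 0| := by
      simpa using abs_add_le (f 0) (f t - f 0)
    rw [Real.norm_eq_abs]
    exact h4.trans (by linarith)
  have hmp := hμ.iterate
  have hSi : ∀ i ∈ Finset.range q, Integrable (fun y => φ (T^[i] y)) μ := fun i _ =>
    (hmp i).integrable_comp_of_integrable hφi
  have hS0 : ∫ y, ∑ i ∈ Finset.range q, φ (T^[i] y) ∂μ = 0 := by
    rw [integral_finsetSum _ hSi]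
    refine Finset.sum_eq_zero fun i _ => ?_
    rw [← hint]
    conv_rhs => rw [← (hmp i).map_eq]
    exact (integral_map (hmp i).aemeasurable hφm.aestronglyMeasurable).symm
  have hmean := norm_integral_le_of_norm_le_const (μ := μ)
    (f := fun y => ∑ i ∈ Finset.range q, φ (T^[i] x) - ∑ i ∈ Finset.range q, φ (T^[i] y))
    (ae_of_all _ hdiff)
  rw [integral_sub (integrable_const _) (integrable_finsetSum _ hSi), hS0] at hmean
  simpa using hmean
end

section
/- (Distortion bound.) Let T : ℝ → ℝ, let n ≥ 1, and let x, y ∈ ℝ. Let J be the closed interval with endpoints x and y, and for 0 ≤ i ≤ n−1 set J_i = T^[i] '' J (the image of J under the i-th iterate of T). Assume: (i) the sets J_0, …, J_{n−1} are pairwise disjoint subsets of [0,1]; (ii) at every point of each J_i, T is differentiable with deriv T > 0, and the function log ∘ (deriv T) is differentiable there with derivative η_T; (iii) |η_T| is integrable on [0,1]. Then deriv (T^[n]) x ≤ exp(V) · deriv (T^[n]) y, where V = ∫₀¹ |η_T(t)| dt; equivalently, the ratio deriv (T^[n]) x / deriv (T^[n]) y is at most exp(∫₀¹ |η_T|). 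-/
open Set intervalIntegral

/-- The chain rule along an orbit. -/
lemma hasDerivAt_iterate_prod {T : ℝ → ℝ} {x : ℝ} {n : ℕ}
    (h : ∀ i < n, DifferentiableAt ℝ T (T^[i] x)) :
    HasDerivAt (T^[n]) (∏ i ∈ Finset.range n, deriv T (T^[i] x)) x := by
  induction n with
  | zero => simpa using hasDerivAt_id x
  | succ n ih =>
    rw [Function.iterate_succ', Finset.prod_range_succ, mul_comm]
    exact (h n n.lt_succ_self).hasDerivAt.comp x (ih fun i hi => h i (hi.trans n.lt_succ_self))

/-- The increment of a differentiable function is at most the integral of the absolute value of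
its derivative. -/
lemma sub_le_setIntegral_abs_of_hasDerivAt {g η : ℝ → ℝ} {a b : ℝ}
    (hg : ∀ z ∈ uIcc a b, HasDerivAt g (η z) z)
    (hint : MeasureTheory.IntegrableOn (fun t => |η t|) (uIoc a b)) :
    g b - g a ≤ ∫ t in uIoc a b, |η t| := by
  have hmeas : MeasureTheory.AEStronglyMeasurable η
      (MeasureTheory.volume.restrict (uIoc a b)) := by
    refine (measurable_deriv g).aestronglyMeasurable.congr ?_
    filter_upwards [MeasureTheory.ae_restrict_mem measurableSet_uIoc] with z hz
    exact (hg z (uIoc_subset_uIcc hz)).deriv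
  have hη : IntervalIntegrable η MeasureTheory.volume a b :=
    intervalIntegrable_iff.2 ((MeasureTheory.integrable_norm_iff hmeas).1 hint)
  rw [← integral_eq_sub_of_hasDerivAt hg hη]
  refine (le_abs_self _).trans ?_
  simpa only [Real.norm_eq_abs] using
    norm_integral_le_integral_norm_uIoc (f := η) (a := a) (b := b) (μ := MeasureTheory.volume)

/-- **Distortion bound.**  Let `T : ℝ → ℝ`, `n ≥ 1`, and let `J` be the closed interval
with endpoints `x` and `y`.  If the iterates `J, T(J), …, T^{n-1}(J)` are pairwise
disjoint subsets of `[0,1]`, if at every point of these sets `T` is differentiable with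
positive derivative and `log ∘ (deriv T)` is differentiable with derivative `η`, and if
`|η|` is integrable on `[0,1]`, then
`deriv (T^[n]) x ≤ exp (∫₀¹ |η|) · deriv (T^[n]) y`. -/
theorem distortion_bound
    (T : ℝ → ℝ) (n : ℕ) (hn : 1 ≤ n) (x y : ℝ)
    (η : ℝ → ℝ)
    (hsub : ∀ i < n, T^[i] '' Set.uIcc x y ⊆ Set.Icc (0 : ℝ) 1)
    (hdisj : ∀ i < n, ∀ j < n, i ≠ j →
      Disjoint (T^[i] '' Set.uIcc x y) (T^[j] '' Set.uIcc x y))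
    (hder : ∀ i < n, ∀ z ∈ T^[i] '' Set.uIcc x y,
      DifferentiableAt ℝ T z ∧ 0 < deriv T z ∧
      HasDerivAt (fun t => Real.log (deriv T t)) (η z) z)
    (hint : MeasureTheory.IntegrableOn (fun t => |η t|) (Set.Icc 0 1)) :
    deriv (T^[n]) x ≤ Real.exp (∫ t in (0:ℝ)..1, |η t|) * deriv (T^[n]) y := by
  have horb : ∀ z ∈ uIcc x y, ∀ i < n, DifferentiableAt ℝ T (T^[i] z) ∧ 0 < deriv T (T^[i] z) :=
    fun z hz i hi => (hder i hi _ (mem_image_of_mem _ hz)).imp_right And.left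
  have hderiv : ∀ z ∈ uIcc x y,
      HasDerivAt (T^[n]) (∏ i ∈ Finset.range n, deriv T (T^[i] z)) z :=
    fun z hz => hasDerivAt_iterate_prod fun i hi => (horb z hz i hi).1
  have himage : ∀ i < n, uIcc (T^[i] y) (T^[i] x) ⊆ T^[i] '' uIcc x y := by
    intro i hi
    rw [uIcc_comm x y]
    refine intermediate_value_uIcc fun z hz => ContinuousAt.continuousWithinAt ?_
    rw [uIcc_comm] at hz
    exact (hasDerivAt_iterate_prod fun k hk => (horb z hz k (hk.trans hi)).1).continuousAt
  have hlog : ∀ z ∈ uIcc x y, Real.log (∏ i ∈ Finset.range n, deriv T (T^[i] z)) =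
      ∑ i ∈ Finset.range n, Real.log (deriv T (T^[i] z)) :=
    fun z hz => Real.log_prod fun i hi => (horb z hz i (Finset.mem_range.1 hi)).2.ne'
  have hpos : ∀ z ∈ uIcc x y, 0 < ∏ i ∈ Finset.range n, deriv T (T^[i] z) :=
    fun z hz => Finset.prod_pos fun i hi => (horb z hz i (Finset.mem_range.1 hi)).2
  let U : ℕ → Set ℝ := fun i => uIoc (T^[i] y) (T^[i] x)
  have hU : ∀ i ∈ Finset.range n, U i ⊆ T^[i] '' uIcc x y := fun i hi =>
    uIoc_subset_uIcc.trans (himage i (Finset.mem_range.1 hi))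
  have hU01 : ∀ i ∈ Finset.range n, U i ⊆ Icc 0 1 := fun i hi =>
    (hU i hi).trans (hsub i (Finset.mem_range.1 hi))
  have hsum : ∑ i ∈ Finset.range n, Real.log (deriv T (T^[i] x)) -
      ∑ i ∈ Finset.range n, Real.log (deriv T (T^[i] y)) ≤ ∫ t in (0:ℝ)..1, |η t| :=
    calc
      _ = ∑ i ∈ Finset.range n,
          (Real.log (deriv T (T^[i] x)) - Real.log (deriv T (T^[i] y))) :=
        (Finset.sum_sub_distrib _ _).symm
      _ ≤ ∑ i ∈ Finset.range n, ∫ t in U i, |η t| :=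
        Finset.sum_le_sum fun i hi =>
          sub_le_setIntegral_abs_of_hasDerivAt (g := fun t => Real.log (deriv T t))
            (fun z hz => (hder i (Finset.mem_range.1 hi) z
              (himage i (Finset.mem_range.1 hi) hz)).2.2)
            (hint.mono_set (hU01 i hi))
      _ = ∫ t in ⋃ i ∈ Finset.range n, U i, |η t| := by
        refine (MeasureTheory.integral_biUnion_finset _ (fun i _ => measurableSet_uIoc) ?_
          fun i hi => hint.mono_set (hU01 i hi)).symm
        intro i hi j hj hij
        exact (hdisj i (by simpa using hi) j (by simpa using hj) hij).mono (hU i hi) (hU j hj)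
      _ ≤ ∫ t in Icc (0:ℝ) 1, |η t| :=
        MeasureTheory.setIntegral_mono_set hint (Filter.Eventually.of_forall fun _ => abs_nonneg _)
          (iUnion₂_subset hU01).eventuallyLE
      _ = ∫ t in (0:ℝ)..1, |η t| := by
        rw [integral_of_le zero_le_one, MeasureTheory.integral_Icc_eq_integral_Ioc]
  rw [(hderiv x left_mem_uIcc).deriv, (hderiv y right_mem_uIcc).deriv]
  rw [← hlog x left_mem_uIcc, ← hlog y right_mem_uIcc] at hsum
  rw [← Real.exp_log (hpos x left_mem_uIcc), ← Real.exp_log (hpos y right_mem_uIcc),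
    ← Real.exp_add, Real.exp_le_exp]
  linarith
end

section
/- (C²-bound for normalized first-return maps.) Let T : ℝ → ℝ, let m ≥ 1, and let J = [u, v] with u < v; for 0 ≤ i ≤ m−1 set J_i = T^[i] '' J. Assume: (i) the sets J_0, …, J_{m−1} are pairwise disjoint subsets of [0,1]; (ii) at every point of each J_i, T is twice differentiable with deriv T > 0, and log ∘ (deriv T) is differentiable there with derivative η_T; (iii) |η_T| is integrable on [0,1], and set V = ∫₀¹ |η_T(t)| dt. Set M₁ = sup_{t ∈ J_0 ∪ ⋯ ∪ J_{m−1}} (deriv T t)⁻¹ and M₂ = sup_{t ∈ J_0 ∪ ⋯ ∪ J_{m−1}} |deriv (deriv T) t|, assumed finite. Then the normalization g = N(T^[m]|_J) : [0,1] → [0,1] of the first-return map satisfies sup_{z ∈ [0,1]} |deriv (deriv g) z| ≤ exp(3V) · M₁ · M₂. -/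
/-- The normalization `N(f)` of a map `f` sending `[a₁,a₂]` onto `[b₁,b₂]`: the map `f`
pre-composed with the increasing affine map sending `[0,1]` onto `[a₁,a₂]` and
post-composed with the increasing affine map sending `[b₁,b₂]` onto `[0,1]`. -/
noncomputable def normalization (f : ℝ → ℝ) (a₁ a₂ b₁ b₂ : ℝ) : ℝ → ℝ :=
  fun x => (f (a₁ + (a₂ - a₁) * x) - b₁) / (b₂ - b₁)

open Set MeasureTheory Filter Topology

/-- A function with integrable derivative oscillates on an interval by at most the integral of
the absolute value of its derivative. -/
lemma sub_le_setIntegral_abs_of_hasDerivAt_s6 {F f : ℝ → ℝ} {p q a b : ℝ}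
    (hF : ∀ z ∈ Icc p q, HasDerivAt F (f z) z)
    (hf : IntegrableOn (fun t => |f t|) (Icc p q))
    (ha : a ∈ Icc p q) (hb : b ∈ Icc p q) :
    F a - F b ≤ ∫ t in Icc p q, |f t| := by
  have hmeas : AEStronglyMeasurable f (volume.restrict (Icc p q)) := by
    refine (measurable_deriv F).aestronglyMeasurable.congr ?_
    filter_upwards [ae_restrict_mem measurableSet_Icc] with z hz
    exact (hF z hz).deriv
  have hfi : IntegrableOn f (Icc p q) := (integrable_norm_iff hmeas).1 hf
  have hsub : uIcc b a ⊆ Icc p q := uIcc_subset_Icc hb ha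
  have hint : IntervalIntegrable f volume b a :=
    (intervalIntegrable_iff).2 (hfi.mono_set (uIoc_subset_uIcc.trans hsub))
  rw [← intervalIntegral.integral_eq_sub_of_hasDerivAt (fun z hz => hF z (hsub hz)) hint]
  refine (le_abs_self _).trans ?_
  refine (intervalIntegral.norm_integral_le_integral_norm_uIoc (f := f)).trans ?_
  exact setIntegral_mono_set hf (ae_of_all _ fun t => abs_nonneg _)
    (uIoc_subset_uIcc.trans hsub).eventuallyLE

/-- The integrals of a nonnegative function over disjoint measurable subsets of `s` sum to at
most its integral over `s`. -/
lemma sum_setIntegral_le_of_pairwiseDisjoint {ι : Type*} {I : Finset ι} {A : ι → Set ℝ}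
    {s : Set ℝ} {f : ℝ → ℝ} (hA : ∀ i ∈ I, MeasurableSet (A i))
    (hd : (I : Set ι).PairwiseDisjoint A) (hs : ∀ i ∈ I, A i ⊆ s)
    (hf : IntegrableOn f s) (hf0 : ∀ t, 0 ≤ f t) :
    ∑ i ∈ I, ∫ t in A i, f t ≤ ∫ t in s, f t := by
  rw [← integral_biUnion_finset I hA hd fun i hi => hf.mono_set (hs i hi)]
  exact setIntegral_mono_set hf (ae_of_all _ hf0) (iUnion₂_subset hs).eventuallyLE

/-- The product of the derivatives of `T` along the first `n` points of the orbit of `x`. -/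
noncomputable def orbitDeriv (T : ℝ → ℝ) (n : ℕ) (x : ℝ) : ℝ :=
  ∏ i ∈ Finset.range n, deriv T (T^[i] x)

lemma hasDerivAt_iterate_orbitDeriv {T : ℝ → ℝ} {n : ℕ} {x : ℝ}
    (h : ∀ i < n, DifferentiableAt ℝ T (T^[i] x)) :
    HasDerivAt T^[n] (orbitDeriv T n x) x := by
  induction n with
  | zero => simpa [orbitDeriv] using hasDerivAt_id x
  | succ n ih =>
    have h1 := ih fun i hi => h i (by omega)
    have h2 := (h n (by omega)).hasDerivAt.comp x h1
    rw [Function.iterate_succ']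
    rw [orbitDeriv, Finset.prod_range_succ, mul_comm]
    exact h2

/-- The logarithmic derivative of `orbitDeriv`. -/
lemma hasDerivAt_orbitDeriv {T : ℝ → ℝ} {n : ℕ} {x : ℝ}
    (h : ∀ i < n, DifferentiableAt ℝ T (T^[i] x) ∧ DifferentiableAt ℝ (deriv T) (T^[i] x) ∧
      0 < deriv T (T^[i] x)) :
    HasDerivAt (orbitDeriv T n) (orbitDeriv T n x * ∑ i ∈ Finset.range n,
      deriv (deriv T) (T^[i] x) / deriv T (T^[i] x) * orbitDeriv T i x) x := by
  induction n with
  | zero =>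
    have : orbitDeriv T 0 = fun _ => 1 := by ext; simp [orbitDeriv]
    simpa [this] using hasDerivAt_const x (1 : ℝ)
  | succ n ih =>
    have h1 := ih fun i hi => h i (by omega)
    have h2 := hasDerivAt_iterate_orbitDeriv fun i (hi : i < n) => (h i (by omega)).1
    have h3 := (h n (by omega)).2.1.hasDerivAt.comp x h2
    have hpos := (h n (by omega)).2.2
    have heq : orbitDeriv T (n + 1) = orbitDeriv T n * (deriv T ∘ T^[n]) := by
      ext y; simp [orbitDeriv, Finset.prod_range_succ]
    rw [heq]
    refine (h1.mul h3).congr_deriv ?_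
    rw [Finset.sum_range_succ]
    simp only [Pi.mul_apply, Function.comp_apply]
    field_simp

lemma eventually_differentiableAt_of_deriv_pos {T : ℝ → ℝ} {x : ℝ}
    (h : DifferentiableAt ℝ (deriv T) x) (hpos : 0 < deriv T x) :
    ∀ᶠ y in 𝓝 x, DifferentiableAt ℝ T y := by
  filter_upwards [h.continuousAt.eventually (lt_mem_nhds hpos)] with y hy
  exact differentiableAt_of_deriv_ne_zero hy.ne'

lemma eventually_hasDerivAt_iterate {T : ℝ → ℝ} {n : ℕ} {x : ℝ}
    (h : ∀ i < n, DifferentiableAt ℝ T (T^[i] x) ∧ DifferentiableAt ℝ (deriv T) (T^[i] x) ∧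
      0 < deriv T (T^[i] x)) :
    ∀ᶠ y in 𝓝 x, HasDerivAt T^[n] (orbitDeriv T n y) y := by
  have : ∀ᶠ y in 𝓝 x, ∀ i ∈ Finset.range n, DifferentiableAt ℝ T (T^[i] y) := by
    rw [Filter.eventually_all_finset]
    intro i hi
    have hi := Finset.mem_range.1 hi
    have hc := (hasDerivAt_iterate_orbitDeriv fun j (hj : j < i) =>
      (h j (by omega)).1).continuousAt
    exact hc.eventually (eventually_differentiableAt_of_deriv_pos (h i hi).2.1 (h i hi).2.2)
  filter_upwards [this] with y hy
  exact hasDerivAt_iterate_orbitDeriv fun i hi => hy i (Finset.mem_range.2 hi)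

lemma iterate_lt_and_image_Icc {T : ℝ → ℝ} {n : ℕ} {u v : ℝ} (huv : u < v)
    (h : ∀ i < n, ∀ z ∈ T^[i] '' Icc u v, DifferentiableAt ℝ T z ∧ 0 < deriv T z) :
    T^[n] u < T^[n] v ∧ T^[n] '' Icc u v = Icc (T^[n] u) (T^[n] v) := by
  induction n with
  | zero => simpa using huv
  | succ n ih =>
    obtain ⟨hlt, himg⟩ := ih fun i hi => h i (by omega)
    have hn := h n (by omega)
    rw [himg] at hn
    have hc : ContinuousOn T (Icc (T^[n] u) (T^[n] v)) := fun z hz =>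
      (hn z hz).1.continuousAt.continuousWithinAt
    have hm : StrictMonoOn T (Icc (T^[n] u) (T^[n] v)) :=
      strictMonoOn_of_deriv_pos (convex_Icc _ _) hc fun z hz => (hn z (interior_subset hz)).2
    have hl := left_mem_Icc.2 hlt.le
    have hr := right_mem_Icc.2 hlt.le
    rw [Function.iterate_succ', image_comp, himg]
    refine ⟨hm hl hr hlt, ?_⟩
    refine Subset.antisymm ?_ (intermediate_value_Icc hlt.le hc)
    rintro _ ⟨z, hz, rfl⟩
    exact ⟨hm.monotoneOn hl hz hz.1, hm.monotoneOn hz hr hz.2⟩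

/-- If the derivative of `T^[n]` varies on `[u, v]` by a factor at most `C`, it is at most `C`
times the mean slope. -/
lemma mul_orbitDeriv_le_of_le_mul {T : ℝ → ℝ} {n : ℕ} {u v x C : ℝ} (huv : u < v)
    (h : ∀ i < n, ∀ z ∈ T^[i] '' Icc u v, DifferentiableAt ℝ T z)
    (hC : ∀ y ∈ Icc u v, orbitDeriv T n x ≤ C * orbitDeriv T n y) :
    (v - u) * orbitDeriv T n x ≤ C * (T^[n] v - T^[n] u) := by
  have hd : ∀ y ∈ Icc u v, HasDerivAt T^[n] (orbitDeriv T n y) y := fun y hy =>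
    hasDerivAt_iterate_orbitDeriv fun i hi => h i hi _ (mem_image_of_mem _ hy)
  obtain ⟨y, hy, hslope⟩ := exists_hasDerivAt_eq_slope T^[n] (orbitDeriv T n) huv
    (fun y hy => (hd y hy).continuousAt.continuousWithinAt)
    (fun y hy => hd y (Ioo_subset_Icc_self hy))
  have huv' : 0 < v - u := sub_pos.2 huv
  rw [eq_div_iff huv'.ne'] at hslope
  rw [← hslope]
  nlinarith [mul_le_mul_of_nonneg_left (hC y (Ioo_subset_Icc_self hy)) huv'.le]

lemma deriv_deriv_normalization_iterate {T : ℝ → ℝ} {n : ℕ} {u v b₁ b₂ z : ℝ}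
    (h : ∀ i < n, DifferentiableAt ℝ T (T^[i] (u + (v - u) * z)) ∧
      DifferentiableAt ℝ (deriv T) (T^[i] (u + (v - u) * z)) ∧
      0 < deriv T (T^[i] (u + (v - u) * z))) :
    deriv (deriv (normalization T^[n] u v b₁ b₂)) z =
      (v - u) * orbitDeriv T n (u + (v - u) * z) / (b₂ - b₁) *
        ∑ i ∈ Finset.range n, deriv (deriv T) (T^[i] (u + (v - u) * z)) /
          deriv T (T^[i] (u + (v - u) * z)) *
          ((v - u) * orbitDeriv T i (u + (v - u) * z)) := by
  have haff : ∀ y, HasDerivAt (fun y : ℝ => u + (v - u) * y) (v - u) y := fun y => by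
    simpa using ((hasDerivAt_id y).const_mul (v - u)).const_add u
  have heq : deriv (normalization T^[n] u v b₁ b₂) =ᶠ[𝓝 z]
      fun y => orbitDeriv T n (u + (v - u) * y) * (v - u) / (b₂ - b₁) := by
    filter_upwards [(haff z).continuousAt.eventually (eventually_hasDerivAt_iterate h)] with y hy
    exact (((hy.comp y (haff y)).sub_const b₁).div_const (b₂ - b₁)).deriv
  rw [heq.deriv_eq]
  refine ((((hasDerivAt_orbitDeriv h).comp z (haff z)).mul_const (v - u)).div_const
    (b₂ - b₁)).deriv.trans ?_
  simp only [mul_left_comm _ (v - u) (orbitDeriv T _ _), ← Finset.mul_sum]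
  ring

/-- **C²-bound for normalized first-return maps.**  Let `J = [u,v]` with iterates
`J, T(J), …, T^{m-1}(J)` pairwise disjoint subsets of `[0,1]`, on which `T` is twice
differentiable with positive derivative and `log ∘ (deriv T)` has derivative `η`, with
`|η|` integrable on `[0,1]` and `V = ∫₀¹ |η|`.  If `M₁` bounds `(deriv T)⁻¹` and `M₂`
bounds `|deriv (deriv T)|` on `J ∪ T(J) ∪ ⋯ ∪ T^{m-1}(J)`, then the normalization `g` of
the first-return map `T^[m]|_J` satisfies `|g''| ≤ exp (3V) · M₁ · M₂` on `[0,1]`. -/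
theorem first_return_second_derivative_bound
    (T : ℝ → ℝ) (m : ℕ) (hm : 1 ≤ m) (u v : ℝ) (huv : u < v)
    (η : ℝ → ℝ)
    (hsub : ∀ i < m, T^[i] '' Set.Icc u v ⊆ Set.Icc (0 : ℝ) 1)
    (hdisj : ∀ i < m, ∀ j < m, i ≠ j →
      Disjoint (T^[i] '' Set.Icc u v) (T^[j] '' Set.Icc u v))
    (hder : ∀ i < m, ∀ z ∈ T^[i] '' Set.Icc u v,
      DifferentiableAt ℝ T z ∧ DifferentiableAt ℝ (deriv T) z ∧ 0 < deriv T z ∧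
      HasDerivAt (fun t => Real.log (deriv T t)) (η z) z)
    (hint : MeasureTheory.IntegrableOn (fun t => |η t|) (Set.Icc 0 1))
    (M₁ M₂ : ℝ)
    (hM₁ : ∀ i < m, ∀ t ∈ T^[i] '' Set.Icc u v, (deriv T t)⁻¹ ≤ M₁)
    (hM₂ : ∀ i < m, ∀ t ∈ T^[i] '' Set.Icc u v, |deriv (deriv T) t| ≤ M₂) :
    ∀ z ∈ Set.Icc (0 : ℝ) 1,
      |deriv (deriv (normalization (T^[m]) u v (T^[m] u) (T^[m] v))) z|
        ≤ Real.exp (3 * ∫ t in (0:ℝ)..1, |η t|) * M₁ * M₂ := by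
  intro z hz
  set V := ∫ t in (0:ℝ)..1, |η t| with hV
  have hVeq : V = ∫ t in Icc (0:ℝ) 1, |η t| := by
    rw [hV, intervalIntegral.integral_of_le zero_le_one, integral_Icc_eq_integral_Ioc]
  have hV0 : 0 ≤ V := hVeq ▸ integral_nonneg fun t => abs_nonneg _
  have himg : ∀ i ≤ m, T^[i] u < T^[i] v ∧ T^[i] '' Icc u v = Icc (T^[i] u) (T^[i] v) :=
    fun i hi => iterate_lt_and_image_Icc huv fun j hj w hw =>
      ⟨(hder j (by omega) w hw).1, (hder j (by omega) w hw).2.2.1⟩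
  have hmeas : ∀ i < m, MeasurableSet (T^[i] '' Icc u v) := fun i hi =>
    (himg i hi.le).2 ▸ measurableSet_Icc
  have hsum : ∀ n ≤ m, ∀ f : ℝ → ℝ, IntegrableOn f (Icc 0 1) → (∀ t, 0 ≤ f t) →
      ∑ i ∈ Finset.range n, ∫ t in T^[i] '' Icc u v, f t ≤ ∫ t in Icc (0:ℝ) 1, f t := by
    intro n hn f hf hf0
    have hlt : ∀ i ∈ Finset.range n, i < m := fun i hi => (Finset.mem_range.1 hi).trans_le hn
    exact sum_setIntegral_le_of_pairwiseDisjoint (fun i hi => hmeas i (hlt i hi))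
      (fun i hi j hj hij => hdisj i (hlt i hi) j (hlt j hj) hij)
      (fun i hi => hsub i (hlt i hi)) hf hf0
  have hpos : ∀ n ≤ m, ∀ y ∈ Icc u v, 0 < orbitDeriv T n y := fun n hn y hy =>
    Finset.prod_pos fun i hi => (hder i ((Finset.mem_range.1 hi).trans_le hn) _
      (mem_image_of_mem _ hy)).2.2.1
  have hdist : ∀ n ≤ m, ∀ x ∈ Icc u v, ∀ y ∈ Icc u v,
      orbitDeriv T n x ≤ Real.exp V * orbitDeriv T n y := by
    intro n hn x hx y hy
    have hlog : ∀ w ∈ Icc u v, Real.log (orbitDeriv T n w) =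
        ∑ i ∈ Finset.range n, Real.log (deriv T (T^[i] w)) := fun w hw =>
      Real.log_prod fun i hi => (hder i ((Finset.mem_range.1 hi).trans_le hn) _
        (mem_image_of_mem _ hw)).2.2.1.ne'
    have hle : Real.log (orbitDeriv T n x) - Real.log (orbitDeriv T n y) ≤ V := by
      rw [hlog x hx, hlog y hy, ← Finset.sum_sub_distrib, hVeq]
      refine (Finset.sum_le_sum fun i hi => ?_).trans
        (hsum n hn _ hint fun t => abs_nonneg _)
      have hi : i < m := (Finset.mem_range.1 hi).trans_le hn
      have hIcc := (himg i hi.le).2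
      have hd := hder i hi
      have hs := hsub i hi
      have hx' := mem_image_of_mem T^[i] hx
      have hy' := mem_image_of_mem T^[i] hy
      rw [hIcc] at hd hs hx' hy' ⊢
      exact sub_le_setIntegral_abs_of_hasDerivAt_s6 (F := fun t => Real.log (deriv T t))
        (fun w hw => (hd w hw).2.2.2) (hint.mono_set hs) hx' hy'
    rw [← Real.exp_log (hpos n hn x hx), ← Real.exp_log (hpos n hn y hy), ← Real.exp_add]
    exact Real.exp_le_exp.2 (by linarith)
  have hlen : ∑ i ∈ Finset.range m, (T^[i] v - T^[i] u) ≤ 1 := by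
    have := hsum m le_rfl (fun _ => 1) (by simp) (fun _ => zero_le_one)
    refine (Finset.sum_le_sum fun i hi => ?_).trans (this.trans (by simp))
    have hi := himg i (Finset.mem_range.1 hi).le
    rw [hi.2]
    simp [hi.1.le]
  set x := u + (v - u) * z with hxdef
  have hx : x ∈ Icc u v := by
    constructor <;> nlinarith [hz.1, hz.2]
  have hslope : ∀ n ≤ m, (v - u) * orbitDeriv T n x ≤ Real.exp V * (T^[n] v - T^[n] u) :=
    fun n hn => mul_orbitDeriv_le_of_le_mul huv (fun i hi w hw => (hder i (by omega) w hw).1)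
      (hdist n hn x hx)
  have huv0 : 0 < v - u := sub_pos.2 huv
  have hM₁0 : 0 ≤ M₁ := (inv_pos.2 (hder 0 hm _ (mem_image_of_mem _ hx)).2.2.1).le.trans
    (hM₁ 0 hm _ (mem_image_of_mem _ hx))
  have hM₂0 : 0 ≤ M₂ := (abs_nonneg _).trans (hM₂ 0 hm _ (mem_image_of_mem _ hx))
  have hmlt : 0 < T^[m] v - T^[m] u := sub_pos.2 (himg m le_rfl).1
  rw [deriv_deriv_normalization_iterate fun i hi =>
    have h := hder i hi _ (mem_image_of_mem _ hx)
    ⟨h.1, h.2.1, h.2.2.1⟩, ← hxdef, abs_mul]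
  have hfst : |(v - u) * orbitDeriv T m x / (T^[m] v - T^[m] u)| ≤ Real.exp V := by
    rw [abs_of_pos (div_pos (mul_pos huv0 (hpos m le_rfl x hx)) hmlt), div_le_iff₀ hmlt]
    exact hslope m le_rfl
  have hsnd : |∑ i ∈ Finset.range m, deriv (deriv T) (T^[i] x) / deriv T (T^[i] x) *
      ((v - u) * orbitDeriv T i x)| ≤ M₁ * M₂ * Real.exp V := by
    calc _ ≤ ∑ i ∈ Finset.range m, M₁ * M₂ * (Real.exp V * (T^[i] v - T^[i] u)) := by
          refine (Finset.abs_sum_le_sum_abs _ _).trans (Finset.sum_le_sum fun i hi => ?_)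
          have hi := Finset.mem_range.1 hi
          have hxi := mem_image_of_mem T^[i] hx
          have hTpos := (hder i hi _ hxi).2.2.1
          have hnn := mul_pos huv0 (hpos i hi.le x hx)
          rw [abs_mul, abs_div, abs_of_pos hTpos, abs_of_pos hnn, div_eq_inv_mul]
          exact mul_le_mul (mul_le_mul (hM₁ i hi _ hxi) (hM₂ i hi _ hxi) (abs_nonneg _) hM₁0)
            (hslope i hi.le) hnn.le (mul_nonneg hM₁0 hM₂0)
      _ = M₁ * M₂ * Real.exp V * ∑ i ∈ Finset.range m, (T^[i] v - T^[i] u) := by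
          rw [Finset.mul_sum]
          exact Finset.sum_congr rfl fun i _ => by ring
      _ ≤ M₁ * M₂ * Real.exp V :=
          mul_le_of_le_one_right (by positivity) hlen
  calc _ ≤ Real.exp V * (M₁ * M₂ * Real.exp V) :=
        mul_le_mul hfst hsnd (abs_nonneg _) (Real.exp_pos V).le
    _ = Real.exp (2 * V) * (M₁ * M₂) := by
        rw [two_mul, Real.exp_add]; ring
    _ ≤ Real.exp (3 * V) * (M₁ * M₂) := by
        gcongr
        norm_num
    _ = Real.exp (3 * V) * M₁ * M₂ := by ring
end
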